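/- Let n be a natural number and G a subgroup of Equiv.Perm (Fin n) such that every orbit of G on Fin n has even cardinality. Then: (a) D u = 0 for every G-invariant element u of C that is homogeneous of degree 1; and (b) for every G-invariant u homogeneous of degree 1 there exists a G-invariant v homogeneous of degree 2 with D v = u. (That is, for the complex of G-invariants (C(𝔽₂)^G, D) one has H₀ ≅ 𝔽₂ and H₁ = 0.) -/

import Mathlib

/-- The down map `D` on the free `𝔽₂`-vector space with basis the subsets of `Fin n`. -/
noncomputable def downMap (n : ℕ) :
    (Finset (Fin n) →₀ ZMod 2) →ₗ[ZMod 2] (Finset (Fin n) →₀ ZMod 2) :=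
  Finsupp.lift _ _ _ fun S => ∑ j ∈ S, Finsupp.single (S.erase j) (1 : ZMod 2)

/-- `u` is `G`-invariant for the linear action `g · e_S = e_{g·S}`. -/
def IsGInvariant (n : ℕ) (G : Subgroup (Equiv.Perm (Fin n)))
    (u : Finset (Fin n) →₀ ZMod 2) : Prop :=
  ∀ g ∈ G, Finsupp.mapDomain (fun S : Finset (Fin n) => S.image ⇑g) u = u

/-- `u` is homogeneous of degree `i`: it lies in the span of the `e_S` with `|S| = i`. -/
def IsHomogeneousDeg (n : ℕ) (i : ℕ) (u : Finset (Fin n) →₀ ZMod 2) : Prop :=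
  u ∈ Submodule.span (ZMod 2)
    {f : Finset (Fin n) →₀ ZMod 2 |
      ∃ S : Finset (Fin n), S.card = i ∧ f = Finsupp.single S (1 : ZMod 2)}

theorem downMap_single (n : ℕ) (S : Finset (Fin n)) (c : ZMod 2) :
    downMap n (Finsupp.single S c) = ∑ j ∈ S, Finsupp.single (S.erase j) c := by
  simp [downMap, Finset.smul_sum]

theorem downMap_apply (n : ℕ) (u : Finset (Fin n) →₀ ZMod 2) (T : Finset (Fin n)) :
    downMap n u T = ∑ j ∈ Tᶜ, u (insert j T) := by
  induction u using Finsupp.induction_linear with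
  | zero => simp
  | add f g hf hg => simp [hf, hg, Finset.sum_add_distrib]
  | single S c =>
    rw [downMap_single, Finsupp.finsetSum_apply]
    simp only [Finsupp.single_apply]
    rw [← Finset.sum_filter, ← Finset.sum_filter]
    congr 1
    ext j
    simp only [Finset.mem_filter, Finset.mem_compl]
    constructor
    · rintro ⟨hj, rfl⟩
      exact ⟨Finset.notMem_erase j S, (Finset.insert_erase hj).symm⟩
    · rintro ⟨hj, rfl⟩
      exact ⟨Finset.mem_insert_self j T, Finset.erase_insert hj⟩

theorem downMap_downMap (n : ℕ) (u : Finset (Fin n) →₀ ZMod 2) :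
    downMap n (downMap n u) = 0 := by
  induction u using Finsupp.induction_linear with
  | zero => simp
  | add f g hf hg => simp [hf, hg]
  | single S c =>
    simp only [downMap_single, map_sum]
    rw [Finset.sum_sigma']
    refine Finset.sum_involution (fun p _ => ⟨p.2, p.1⟩) ?_ ?_ ?_ ?_
    · rintro ⟨i, j⟩ -
      rw [Finset.erase_right_comm, ← Finsupp.single_add, CharTwo.add_self_eq_zero,
        Finsupp.single_zero]
    · rintro ⟨i, j⟩ h - heq
      simp only [Finset.mem_sigma, Finset.mem_erase] at h
      exact h.2.1 (congrArg Sigma.fst heq)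
    · rintro ⟨i, j⟩ h
      simp only [Finset.mem_sigma, Finset.mem_erase] at h ⊢
      exact ⟨h.2.2, Ne.symm h.2.1, h.1⟩
    · rintro ⟨i, j⟩ -
      rfl

theorem isGInvariant_iff {n : ℕ} {G : Subgroup (Equiv.Perm (Fin n))}
    {u : Finset (Fin n) →₀ ZMod 2} :
    IsGInvariant n G u ↔ ∀ g ∈ G, ∀ S : Finset (Fin n), u (S.image g) = u S := by
  refine forall₂_congr fun g _ => ?_
  have hinj : Function.Injective fun S : Finset (Fin n) => S.image g :=
    Finset.image_injective g.injective
  constructor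
  · intro h S
    conv_lhs => rw [← h]
    exact Finsupp.mapDomain_apply hinj u S
  · intro h
    ext T
    obtain ⟨S, rfl⟩ : ∃ S : Finset (Fin n), S.image g = T :=
      ⟨T.image g.symm, by simp [Finset.image_image]⟩
    exact (Finsupp.mapDomain_apply hinj u S).trans (h S).symm

theorem isHomogeneousDeg_iff {n i : ℕ} {u : Finset (Fin n) →₀ ZMod 2} :
    IsHomogeneousDeg n i u ↔ ∀ S : Finset (Fin n), u S ≠ 0 → S.card = i := by
  have hset : {f : Finset (Fin n) →₀ ZMod 2 |
      ∃ S : Finset (Fin n), S.card = i ∧ f = Finsupp.single S (1 : ZMod 2)} =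
      (fun S => Finsupp.single S (1 : ZMod 2)) '' {S | S.card = i} := by
    ext f
    simp [eq_comm]
  rw [IsHomogeneousDeg, hset, ← Finsupp.supported_eq_span_single, Finsupp.mem_supported]
  simp [Set.subset_def]

/-- The indicator of the pairs inside a single `G`-orbit whose elements all lie in the support of
the degree `1` part of `u`. -/
noncomputable def orbitPairs {n : ℕ} (G : Subgroup (Equiv.Perm (Fin n)))
    (u : Finset (Fin n) →₀ ZMod 2) : Finset (Fin n) →₀ ZMod 2 :=
  open Classical in
  Finsupp.equivFunOnFinite.symm fun S =>
    if S.card = 2 ∧ ∀ a ∈ S, u {a} ≠ 0 ∧ ∀ b ∈ S, a ∈ MulAction.orbit G b then 1 else 0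

open Classical in
theorem orbitPairs_apply {n : ℕ} (G : Subgroup (Equiv.Perm (Fin n)))
    (u : Finset (Fin n) →₀ ZMod 2) (S : Finset (Fin n)) :
    orbitPairs G u S =
      if S.card = 2 ∧ ∀ a ∈ S, u {a} ≠ 0 ∧ ∀ b ∈ S, a ∈ MulAction.orbit G b then 1 else 0 :=
  rfl

theorem isHomogeneousDeg_orbitPairs {n : ℕ} (G : Subgroup (Equiv.Perm (Fin n)))
    (u : Finset (Fin n) →₀ ZMod 2) : IsHomogeneousDeg n 2 (orbitPairs G u) := by
  classical
  rw [isHomogeneousDeg_iff]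
  intro S hS
  by_contra hcard
  simp [orbitPairs_apply, hcard] at hS

theorem IsGInvariant.apply_singleton {n : ℕ} {G : Subgroup (Equiv.Perm (Fin n))}
    {u : Finset (Fin n) →₀ ZMod 2} (hu : IsGInvariant n G u) {g : Equiv.Perm (Fin n)}
    (hg : g ∈ G) (a : Fin n) : u {g a} = u {a} := by
  simpa using isGInvariant_iff.1 hu g hg {a}

theorem IsGInvariant.orbitPairs {n : ℕ} {G : Subgroup (Equiv.Perm (Fin n))}
    {u : Finset (Fin n) →₀ ZMod 2} (hu : IsGInvariant n G u) :
    IsGInvariant n G (orbitPairs G u) := by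
  classical
  rw [isGInvariant_iff]
  intro g hg S
  have horbit (a b : Fin n) : g a ∈ MulAction.orbit G (g b) ↔ a ∈ MulAction.orbit G b := by
    have hmk (c : Fin n) : MulAction.orbit G (g c) = MulAction.orbit G c :=
      MulAction.orbit_eq_iff.2 ⟨⟨g, hg⟩, rfl⟩
    rw [hmk, ← MulAction.orbit_eq_iff, hmk, MulAction.orbit_eq_iff]
  simp only [orbitPairs_apply, Finset.card_image_of_injective S g.injective,
    Finset.forall_mem_image, hu.apply_singleton hg, horbit]

theorem downMap_orbitPairs {n : ℕ} {G : Subgroup (Equiv.Perm (Fin n))}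
    (heven : ∀ x : Fin n, Even (Nat.card (MulAction.orbit G x)))
    {u : Finset (Fin n) →₀ ZMod 2} (hu : IsGInvariant n G u) (hdeg : IsHomogeneousDeg n 1 u) :
    downMap n (orbitPairs G u) = u := by
  classical
  ext T
  rw [downMap_apply]
  by_cases hT : T.card = 1
  · obtain ⟨x, rfl⟩ := Finset.card_eq_one.1 hT
    have hcoeff : ∀ j ∈ ({x} : Finset (Fin n))ᶜ, orbitPairs G u {j, x} =
        if j ∈ MulAction.orbit G x then u {x} else 0 := by
      intro j hj
      have hjx : j ≠ x := by simpa using hj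
      have huj (h : j ∈ MulAction.orbit G x) : u {j} = u {x} := by
        obtain ⟨g, rfl⟩ := h
        exact hu.apply_singleton g.2 x
      have hsymm : x ∈ MulAction.orbit G j ↔ j ∈ MulAction.orbit G x :=
        MulAction.mem_orbit_symm
      have hux : u {x} = 0 ∨ u {x} = 1 := by
        generalize u {x} = c
        revert c
        decide
      rw [orbitPairs_apply]
      by_cases h : j ∈ MulAction.orbit G x
      · rcases hux with hux | hux <;>
          simp [Finset.card_pair hjx, h, hsymm, huj h, hux]
      · simp [h]
    rw [Finset.sum_congr rfl hcoeff, ← Finset.sum_filter, Finset.sum_const]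
    have hfilter : ({x} : Finset (Fin n))ᶜ.filter (· ∈ MulAction.orbit G x) =
        (MulAction.orbit G x).toFinset.erase x := by
      ext j
      simp
    have hodd : Odd ((MulAction.orbit G x).toFinset.erase x).card := by
      have h := heven x
      rw [Nat.card_eq_card_toFinset] at h
      have hmem : x ∈ (MulAction.orbit G x).toFinset := by simp
      rw [← Finset.card_erase_add_one hmem] at h
      grind
    rw [hfilter, nsmul_eq_mul, ZMod.natCast_eq_one_iff_odd.2 hodd, one_mul]
  · have huT : u T = 0 := by
      by_contra h
      exact hT (isHomogeneousDeg_iff.1 hdeg T h)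
    rw [huT]
    refine Finset.sum_eq_zero fun j hj => ?_
    by_contra h
    have hcard := isHomogeneousDeg_iff.1 (isHomogeneousDeg_orbitPairs G u) _ h
    rw [Finset.card_insert_of_notMem (Finset.mem_compl.1 hj)] at hcard
    omega

/-- (Theorem 2.7, last part.) If every orbit of `G` on `Fin n` has even cardinality, then in the
complex of `G`-invariants `(C(𝔽₂)^G, D)` one has: (a) `D` vanishes on invariants of degree `1`,
and (b) every invariant of degree `1` is the boundary of an invariant of degree `2`
(so `H₀ ≅ 𝔽₂` and `H₁ = 0`). -/
theorem invariant_complex_H0_H1 (n : ℕ) (G : Subgroup (Equiv.Perm (Fin n)))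
    (heven : ∀ x : Fin n, Even (Nat.card (MulAction.orbit G x))) :
    (∀ u : Finset (Fin n) →₀ ZMod 2,
      IsGInvariant n G u → IsHomogeneousDeg n 1 u → downMap n u = 0) ∧
    (∀ u : Finset (Fin n) →₀ ZMod 2,
      IsGInvariant n G u → IsHomogeneousDeg n 1 u →
        ∃ v : Finset (Fin n) →₀ ZMod 2,
          IsGInvariant n G v ∧ IsHomogeneousDeg n 2 v ∧ downMap n v = u) := by
  refine ⟨fun u hu hdeg => ?_, fun u hu hdeg => ⟨orbitPairs G u, hu.orbitPairs,
    isHomogeneousDeg_orbitPairs G u, downMap_orbitPairs heven hu hdeg⟩⟩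
  rw [← downMap_orbitPairs heven hu hdeg, downMap_downMap]
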